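/- For every integer n ≥ 1 there exists a bijection φ from the set of Catalan tableaux of index n to the set of binary trees with n vertices such that for every Catalan tableau T of index n, the profile of T equals the canopy of the binary tree φ(T). -/

import Mathlib

/-- A binary tree: empty, or a root with a left and a right subtree. -/
inductive BinTree : Type
  | nil : BinTree
  | node : BinTree → BinTree → BinTree
  deriving DecidableEq

/-- Number of vertices of a binary tree. -/
def BinTree.size : BinTree → ℕ
  | .nil => 0
  | .node l r => l.size + r.size + 1

/-- Length (number of vertices) of the left branch. -/
def BinTree.leftBranchLen : BinTree → ℕ
  | .nil => 0
  | .node l _ => l.leftBranchLen + 1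

/-- Length (number of vertices) of the right branch. -/
def BinTree.rightBranchLen : BinTree → ℕ
  | .nil => 0
  | .node _ r => r.rightBranchLen + 1

/-- Word over {a,b} (a = `true`, b = `false`) reading the vertices in symmetric
(in-)order; a vertex contributes `true` iff it has a right child. -/
def BinTree.canopyFull : BinTree → List Bool
  | .nil => []
  | .node l r => l.canopyFull ++ (decide (r ≠ BinTree.nil)) :: r.canopyFull

/-- The canopy of a binary tree with `n` vertices: the word `u₁ … u_{n-1}` over
{a = `true`, b = `false`} with `uᵢ = a` iff the `i`-th vertex in symmetric order
has a right child.  (The last vertex in symmetric order never has a right child,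
so it is dropped.) -/
def BinTree.canopy (B : BinTree) : List Bool := B.canopyFull.dropLast

/-- A Catalan tableau of index `n`: a partition `λ₁ ≥ … ≥ λ_k` with `λ₁ = n - k`,
drawn right-justified inside the `k × (n-k)` rectangle (rows bottom to top, row `i`
having `lam i` cells, occupying columns `j` with `m - lam i ≤ j < m` where
`m = n - k`), filled with 0's (`false`) and 1's (`true`) such that every column
contains exactly one 1 and no 0 has both a 1 below it in its column and a 1 to
its right in its row.  Entries outside the diagram are forced to `false`. -/
structure CatalanTableau (n : ℕ) where
  k : ℕ
  m : ℕ
  hk : 0 < k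
  hkm : k + m = n
  lam : Fin k → ℕ
  lam_le : ∀ i, lam i ≤ m
  lam_first : lam ⟨0, hk⟩ = m
  lam_anti : ∀ i j : Fin k, i ≤ j → lam j ≤ lam i
  f : Fin k → Fin m → Bool
  f_outside : ∀ (i : Fin k) (j : Fin m), (j : ℕ) < m - lam i → f i j = false
  col_one : ∀ j : Fin m, ∃! i : Fin k, f i j = true
  no_bad : ∀ (i : Fin k) (j : Fin m), m - lam i ≤ (j : ℕ) → f i j = false →
    ¬ ((∃ i' : Fin k, i' < i ∧ f i' j = true) ∧
       (∃ j' : Fin m, (j : ℕ) < (j' : ℕ) ∧ f i j' = true))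

/-- The profile of a Catalan tableau: the NW border of its Ferrers diagram read
from the bottom-left corner of the rectangle to its top-right corner
(a = `true` for a north step, b = `false` for an east step), with the first
letter (always a north step) deleted. -/
def CatalanTableau.profile {n : ℕ} (T : CatalanTableau n) : List Bool :=
  ((List.finRange T.k).flatMap (fun i =>
    true :: List.replicate
      (T.lam i - (if h : (i : ℕ) + 1 < T.k then T.lam ⟨(i : ℕ) + 1, h⟩ else 0)) false)).tail

/-- Number of 1's in the first (bottom) row of a Catalan tableau. -/
noncomputable def CatalanTableau.onesFirstRow {n : ℕ} (T : CatalanTableau n) : ℕ :=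
  Nat.card {j : Fin T.m // T.f ⟨0, T.hk⟩ j = true}

/-- An entry is restricted if it is a 0 (in a cell of the diagram) lying above
some 1 in its column. -/
def CatalanTableau.Restricted {n : ℕ} (T : CatalanTableau n)
    (i : Fin T.k) (j : Fin T.m) : Prop :=
  T.m - T.lam i ≤ (j : ℕ) ∧ T.f i j = false ∧ ∃ i' : Fin T.k, i' < i ∧ T.f i' j = true

/-- Number of unrestricted rows (rows of the rectangle containing no restricted
entry). -/
noncomputable def CatalanTableau.unrestrictedRows {n : ℕ} (T : CatalanTableau n) : ℕ :=
  Nat.card {i : Fin T.k // ∀ j : Fin T.m, ¬ T.Restricted i j}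

/-- `weaklyBelow ω η`: the lattice paths coded by `ω`, `η` (a = `true` = north
step, b = `false` = east step, both starting at the origin) have the same
endpoints and `η` never passes strictly above `ω`. -/
def weaklyBelow (ω η : List Bool) : Prop :=
  η.length = ω.length ∧ η.count true = ω.count true ∧
    ∀ t : ℕ, (η.take t).count true ≤ (ω.take t).count true

/-- Heights at which the successive east steps of a path occur. -/
def eastHeightsAux : ℕ → List Bool → List ℕ
  | _, [] => []
  | h, true :: w => eastHeightsAux (h + 1) w
  | h, false :: w => h :: eastHeightsAux h w

def eastHeights (w : List Bool) : List ℕ := eastHeightsAux 0 w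

/-- Number of horizontal contacts of two paths: unit east edges traversed by
both paths. -/
def contacts (ω η : List Bool) : ℕ :=
  ((eastHeights ω).zip (eastHeights η)).countP (fun p => p.1 == p.2)

/-- Number of trailing north steps of a path. -/
def trailingNorth (w : List Bool) : ℕ := (w.reverse.takeWhile (· == true)).length

/-- Number of left edges, i.e. of vertices having a left child. -/
def BinTree.leftEdgeCount : BinTree → ℕ
  | .nil => 0
  | .node l r => l.leftEdgeCount + r.leftEdgeCount + (if l = BinTree.nil then 0 else 1)

/-- Number of vertices having no right child. -/
def BinTree.noRightCount : BinTree → ℕ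
  | .nil => 0
  | .node l r => l.noRightCount + r.noRightCount + (if r = BinTree.nil then 1 else 0)

/-- Symmetric-order traversal recording, for each vertex, whether it has a left
child, whether it has a right child, and its right height (the second argument
is the right height of the current root). -/
def BinTree.inorderAux : BinTree → ℕ → List (Bool × Bool × ℕ)
  | .nil, _ => []
  | .node l r, h =>
      BinTree.inorderAux l h ++
        (decide (l ≠ BinTree.nil), decide (r ≠ BinTree.nil), h) :: BinTree.inorderAux r (h + 1)

def BinTree.inorder (B : BinTree) : List (Bool × Bool × ℕ) := B.inorderAux 0

/-- The sequence `ρ₁, …, ρ_m`: right heights of the parents of the left edges,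
the left edges being ordered by their parents in symmetric order. -/
def BinTree.rhoList (B : BinTree) : List ℕ :=
  (B.inorder.filter (fun v => v.1)).map (fun v => v.2.2)

def hsAux : List (Bool × Bool × ℕ) → ℕ → List ℕ
  | [], _ => []
  | v :: rest, c => if v.2.1 then hsAux rest (c + 1) else c :: hsAux rest c

/-- The sequence `h₁, …, h_m`: for each vertex with no right child (in symmetric
order, excluding the last vertex in symmetric order), the number of vertices
preceding it in symmetric order that have a right child. -/
def BinTree.hList (B : BinTree) : List ℕ := (hsAux B.inorder 0).dropLast

/-- Leaves of the completion `γ(B)` in symmetric order, each recorded as `true`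
if it is a left child of its parent and `false` if it is a right child; the
boolean argument records whether the current subtree sits as a left child. -/
def BinTree.gammaLeavesAux : BinTree → Bool → List Bool
  | .nil, isLeft => [isLeft]
  | .node l r, _ => BinTree.gammaLeavesAux l true ++ BinTree.gammaLeavesAux r false

/-- The word of the leaves of the complete binary tree `γ(B)` in symmetric order
(a = `true` for a left child, b = `false` for a right child). -/
def BinTree.leafWord : BinTree → List Bool
  | .nil => []
  | .node l r => BinTree.gammaLeavesAux l true ++ BinTree.gammaLeavesAux r false


/-- A graded family of objects generated along the Catalan generating tree: an object `x` with
statistic `s` has exactly one child of each statistic `1, …, s + 1`.  The word of an object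
records at which steps the statistic increased. -/
structure CatalanFamily (X : ℕ → Type) where
  stat : ∀ {n}, X n → ℕ
  word : ∀ {n}, X n → List Bool
  parent : ∀ {n}, X (n + 1) → X n
  root : X 0
  eq_root : ∀ x : X 0, x = root
  stat_root : stat root = 0
  word_root : word root = []
  stat_pos : ∀ {n} (x : X (n + 1)), 1 ≤ stat x
  stat_le : ∀ {n} (x : X (n + 1)), stat x ≤ stat (parent x) + 1
  parent_inj : ∀ {n} (x y : X (n + 1)), parent x = parent y → stat x = stat y → x = y
  exists_child : ∀ {n} (x : X n) (t : ℕ), t ≤ stat x → ∃ y, parent y = x ∧ stat y = t + 1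
  word_succ : ∀ {n} (x : X (n + 1)),
    word x = word (parent x) ++ [decide (stat x = stat (parent x) + 1)]

namespace CatalanFamily

variable {X Y : ℕ → Type}

/-- An object of positive size amounts to its parent together with an admissible statistic. -/
noncomputable def succEquiv (F : CatalanFamily X) (n : ℕ) :
    X (n + 1) ≃ {q : X n × ℕ // 1 ≤ q.2 ∧ q.2 ≤ F.stat q.1 + 1} :=
  Equiv.ofBijective (fun x => ⟨(F.parent x, F.stat x), F.stat_pos x, F.stat_le x⟩) <| by
    constructor
    · intro x y h
      simp only [Subtype.mk.injEq, Prod.mk.injEq] at h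
      exact F.parent_inj x y h.1 h.2
    · rintro ⟨⟨x, t⟩, h1, h2⟩
      dsimp only at h1 h2
      obtain ⟨y, rfl, hy⟩ := F.exists_child x (t - 1) (by omega)
      refine ⟨y, ?_⟩
      simp only [Subtype.mk.injEq, Prod.mk.injEq, true_and]
      omega

theorem exists_equiv (F : CatalanFamily X) (G : CatalanFamily Y) (n : ℕ) :
    ∃ e : X n ≃ Y n, ∀ x, F.stat x = G.stat (e x) ∧ F.word x = G.word (e x) := by
  induction n with
  | zero =>
    refine ⟨⟨fun _ => G.root, fun _ => F.root, fun x => (F.eq_root x).symm,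
      fun y => (G.eq_root y).symm⟩, fun x => ?_⟩
    rw [F.eq_root x]
    exact ⟨F.stat_root.trans G.stat_root.symm, F.word_root.trans G.word_root.symm⟩
  | succ n ih =>
    obtain ⟨e, he⟩ := ih
    let e' : {q : X n × ℕ // 1 ≤ q.2 ∧ q.2 ≤ F.stat q.1 + 1} ≃
        {q : Y n × ℕ // 1 ≤ q.2 ∧ q.2 ≤ G.stat q.1 + 1} :=
      (e.prodCongr (Equiv.refl ℕ)).subtypeEquiv fun q => by simp [(he q.1).1]
    refine ⟨(F.succEquiv n).trans (e'.trans (G.succEquiv n).symm), fun x => ?_⟩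
    set y := ((F.succEquiv n).trans (e'.trans (G.succEquiv n).symm)) x with hy
    have h : G.succEquiv n y = e' (F.succEquiv n x) := by simp [hy]
    have h1 : G.parent y = e (F.parent x) := congrArg (fun q => q.1.1) h
    have h2 : G.stat y = F.stat x := congrArg (fun q => q.1.2) h
    refine ⟨h2.symm, ?_⟩
    rw [F.word_succ, G.word_succ, h1, h2, (he _).1, (he _).2]

end CatalanFamily

namespace BinTree

/-- Insert a new last vertex (in symmetric order) at depth `t` of the right branch. -/
def insertLast : BinTree → ℕ → BinTree
  | .nil, _ => .node .nil .nil
  | .node l r, 0 => .node (.node l r) .nil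
  | .node l r, t + 1 => .node l (r.insertLast t)

/-- Delete the last vertex in symmetric order. -/
def deleteLast : BinTree → BinTree
  | .nil => .nil
  | .node l .nil => l
  | .node l (.node rl rr) => .node l (deleteLast (.node rl rr))

/-- The canopy preceded by the letter `a`; empty for the empty tree. -/
def canopyWord : BinTree → List Bool
  | .nil => []
  | .node l r => true :: (BinTree.node l r).canopy

theorem insertLast_ne_nil (B : BinTree) (t : ℕ) : B.insertLast t ≠ .nil := by
  cases B <;> cases t <;> simp [insertLast]

theorem size_insertLast (B : BinTree) (t : ℕ) : (B.insertLast t).size = B.size + 1 := by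
  induction B generalizing t with
  | nil => rfl
  | node l r _ ihr =>
    cases t with
    | zero => simp [insertLast, size]
    | succ t => simp only [insertLast, size, ihr]; omega

theorem rightBranchLen_insertLast (B : BinTree) (t : ℕ) (ht : t ≤ B.rightBranchLen) :
    (B.insertLast t).rightBranchLen = t + 1 := by
  induction B generalizing t with
  | nil => simp only [rightBranchLen] at ht; simp [insertLast, rightBranchLen]; omega
  | node l r _ ihr =>
    cases t with
    | zero => simp [insertLast, rightBranchLen]
    | succ t =>
      simp only [rightBranchLen] at ht
      simp only [insertLast, rightBranchLen, ihr t (by omega)]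

theorem deleteLast_insertLast (B : BinTree) (t : ℕ) : (B.insertLast t).deleteLast = B := by
  induction B generalizing t with
  | nil => rfl
  | node l r _ ihr =>
    cases t with
    | zero => rfl
    | succ t =>
      have h := ihr t
      simp only [insertLast]
      cases hr : r.insertLast t with
      | nil => exact absurd hr (insertLast_ne_nil r t)
      | node l' r' => rw [hr] at h; rw [deleteLast, h]

theorem insertLast_deleteLast (B : BinTree) (hB : B ≠ .nil) :
    B.deleteLast.insertLast (B.rightBranchLen - 1) = B := by
  induction B with
  | nil => exact absurd rfl hB
  | node l r _ ihr =>
    cases r with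
    | nil => cases l <;> rfl
    | node l' r' =>
      have h := ihr (by simp)
      simp only [rightBranchLen, Nat.add_sub_cancel, deleteLast, insertLast] at h ⊢
      rw [h]

theorem rightBranchLen_le (B : BinTree) :
    B.rightBranchLen ≤ B.deleteLast.rightBranchLen + 1 := by
  induction B with
  | nil => simp [rightBranchLen]
  | node l r _ ihr =>
    cases r with
    | nil => simp [rightBranchLen]
    | node l' r' => simpa [rightBranchLen, deleteLast] using ihr

theorem size_deleteLast (B : BinTree) (hB : B ≠ .nil) : B.deleteLast.size + 1 = B.size := by
  conv_rhs => rw [← insertLast_deleteLast B hB, size_insertLast]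

theorem canopyFull_ne_nil {B : BinTree} (hB : B ≠ .nil) : B.canopyFull ≠ [] := by
  cases B <;> simp_all [canopyFull]

theorem canopy_append (B : BinTree) (hB : B ≠ .nil) : B.canopy ++ [false] = B.canopyFull := by
  induction B with
  | nil => exact absurd rfl hB
  | node l r _ ihr =>
    cases r with
    | nil => simp [canopy, canopyFull]
    | node l' r' =>
      have h := ihr (by simp)
      have h0 := canopyFull_ne_nil (B := .node l' r') (by simp)
      unfold canopy at h ⊢
      rw [canopyFull, List.dropLast_append_of_ne_nil (by simp),
        List.dropLast_cons_of_ne_nil h0, List.append_assoc, List.cons_append, h]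

theorem canopyFull_insertLast (B : BinTree) (hB : B ≠ .nil) (t : ℕ) (ht : t ≤ B.rightBranchLen) :
    (B.insertLast t).canopyFull = B.canopy ++ [decide (t = B.rightBranchLen), false] := by
  induction B generalizing t with
  | nil => exact absurd rfl hB
  | node l r _ ihr =>
    cases t with
    | zero =>
      have h := canopy_append (.node l r) hB
      simp only [insertLast]
      rw [canopyFull, ← h]
      simp [canopyFull, rightBranchLen]
    | succ t =>
      cases r with
      | nil =>
        have : t = 0 := by simpa [rightBranchLen] using ht
        subst this
        simp [insertLast, canopyFull, canopy, rightBranchLen]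
      | node l' r' =>
        have h := ihr (by simp) t (by simpa [rightBranchLen] using ht)
        have h0 := canopyFull_ne_nil (B := .node l' r') (by simp)
        have hc : (BinTree.node l (.node l' r')).canopy =
            l.canopyFull ++ true :: (BinTree.node l' r').canopy := by
          unfold canopy
          rw [canopyFull, List.dropLast_append_of_ne_nil (by simp),
            List.dropLast_cons_of_ne_nil h0]
          simp
        rw [hc, insertLast, canopyFull, h]
        simp only [rightBranchLen, ne_eq, insertLast_ne_nil, not_false_eq_true, decide_true,
          List.append_assoc, List.cons_append, Nat.add_right_cancel_iff]
        congr

theorem canopyWord_insertLast (B : BinTree) (t : ℕ) (ht : t ≤ B.rightBranchLen) :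
    (B.insertLast t).canopyWord = B.canopyWord ++ [decide (t = B.rightBranchLen)] := by
  cases B with
  | nil =>
    have : t = 0 := by simpa [rightBranchLen] using ht
    subst this
    rfl
  | node l r =>
    have h := canopyFull_insertLast (.node l r) (by simp) t ht
    have h' : ∀ B : BinTree, B ≠ .nil → B.canopyWord = true :: B.canopy := by
      intro B hB
      cases B <;> simp_all [canopyWord]
    rw [h' _ (insertLast_ne_nil _ _), h' _ (by simp), canopy, h]
    rw [List.dropLast_append_of_ne_nil (by simp)]
    simp

theorem ne_nil_of_size_eq_succ {n : ℕ} {B : BinTree} (h : B.size = n + 1) : B ≠ .nil := by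
  rintro rfl
  simp [size] at h

theorem rightBranchLen_pos {B : BinTree} (h : B ≠ .nil) : 1 ≤ B.rightBranchLen := by
  cases B <;> simp_all [rightBranchLen]

/-- Binary trees, graded by size, with the length of the right branch as statistic. -/
def catalanFamily : CatalanFamily fun n => {B : BinTree // B.size = n} where
  stat B := B.1.rightBranchLen
  word B := B.1.canopyWord
  parent B := ⟨B.1.deleteLast, by
    have := size_deleteLast B.1 (ne_nil_of_size_eq_succ B.2)
    have := B.2
    omega⟩
  root := ⟨.nil, rfl⟩
  eq_root := by
    rintro ⟨B, hB⟩
    cases B with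
    | nil => rfl
    | node l r => exact absurd hB (by simp [size])
  stat_root := rfl
  word_root := rfl
  stat_pos B := rightBranchLen_pos (ne_nil_of_size_eq_succ B.2)
  stat_le B := rightBranchLen_le B.1
  parent_inj B C h h' := by
    simp only [Subtype.mk.injEq] at h
    apply Subtype.ext
    rw [← insertLast_deleteLast B.1 (ne_nil_of_size_eq_succ B.2), h, h',
      insertLast_deleteLast C.1 (ne_nil_of_size_eq_succ C.2)]
  exists_child B t ht :=
    ⟨⟨B.1.insertLast t, by rw [size_insertLast, B.2]⟩,
      Subtype.ext (deleteLast_insertLast B.1 t), rightBranchLen_insertLast B.1 t ht⟩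
  word_succ B := by
    have hB := ne_nil_of_size_eq_succ B.2
    have h1 := rightBranchLen_pos hB
    have h2 := rightBranchLen_le B.1
    conv_lhs => rw [← insertLast_deleteLast B.1 hB]
    rw [canopyWord_insertLast _ _ (by omega)]
    congr 3
    simp only [eq_iff_iff]
    omega

end BinTree

/-- A tableau with `k` rows given by its columns from right to left, each recorded as its height
and the row of its unique `1`. -/
def IsColumnList (k : ℕ) (L : List (ℕ × ℕ)) : Prop :=
  (∀ c ∈ L, c.2 < c.1 ∧ c.1 ≤ k) ∧
    L.Pairwise fun c d => d.1 ≤ c.1 ∧ (c.2 < d.1 → c.2 ≤ d.2)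

namespace IsColumnList

/-- Row `i` has no `0` lying above a `1`. -/
def Unrestricted (L : List (ℕ × ℕ)) (i : ℕ) : Prop := ∀ c ∈ L, i < c.1 → i ≤ c.2

instance (L : List (ℕ × ℕ)) : DecidablePred (Unrestricted L) := fun _ => List.decidableBAll _ _

/-- The border of the diagram, read from bottom left to top right. -/
def word (k : ℕ) (L : List (ℕ × ℕ)) : List Bool :=
  (List.range k).flatMap fun i => true :: List.replicate (L.countP fun c => c.1 = i + 1) false

/-- Remove the last step of the border: the rightmost column if it is full, and otherwise the
top row. -/
def parent : ℕ × List (ℕ × ℕ) → ℕ × List (ℕ × ℕ)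
  | (k, []) => (k - 1, [])
  | (k, c :: L) => if c.1 = k then (k, L) else (k - 1, c :: L)

/-- The number of unrestricted rows. -/
def stat (q : ℕ × List (ℕ × ℕ)) : ℕ := Nat.count (Unrestricted q.2) q.1

variable {k p : ℕ} {L : List (ℕ × ℕ)}

theorem addRow (h : IsColumnList k L) : IsColumnList (k + 1) L :=
  ⟨fun c hc => ⟨(h.1 c hc).1, (h.1 c hc).2.trans (Nat.le_succ k)⟩, h.2⟩

theorem addColumn_iff :
    IsColumnList k ((k, p) :: L) ↔ IsColumnList k L ∧ p < k ∧ Unrestricted L p := by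
  simp only [IsColumnList, Unrestricted, List.forall_mem_cons, List.pairwise_cons, le_refl,
    and_true]
  constructor
  · rintro ⟨⟨h1, h2⟩, h3, h4⟩
    exact ⟨⟨h2, h4⟩, h1, fun c hc => (h3 c hc).2⟩
  · rintro ⟨⟨h2, h4⟩, h1, h3⟩
    exact ⟨⟨h1, h2⟩, fun c hc => ⟨(h2 c hc).2, h3 c hc⟩, h4⟩

theorem parent_addRow (h : IsColumnList k L) : parent (k + 1, L) = (k, L) := by
  cases L with
  | nil => rfl
  | cons c L =>
    have := (h.1 c (by simp)).2
    rw [parent, if_neg (by omega)]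
    rfl

theorem parent_addColumn : parent (k, (k, p) :: L) = (k, L) := by simp [parent]

theorem stat_addRow (h : IsColumnList k L) : stat (k + 1, L) = stat (k, L) + 1 := by
  simp only [stat]
  rw [Nat.count_succ, if_pos]
  intro c hc hk
  exact absurd (h.1 c hc).2 (by omega)

theorem stat_addColumn (hp : p < k) (hu : Unrestricted L p) :
    stat (k, (k, p) :: L) = Nat.count (Unrestricted L) p + 1 := by
  have h : ∀ i, i < k → (Unrestricted ((k, p) :: L) i ↔ Unrestricted L i ∧ i < p + 1) := by
    intro i hi
    simp only [Unrestricted, List.forall_mem_cons, hi, true_imp_iff, Nat.lt_succ_iff]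
    exact and_comm
  have h1 : Nat.count (Unrestricted L) (p + 1) = Nat.count (Unrestricted L) p + 1 := by
    rw [Nat.count_succ, if_pos hu]
  rw [← h1, stat, Nat.count_eq_card_filter_range, Nat.count_eq_card_filter_range]
  congr 1
  ext i
  simp only [Finset.mem_filter, Finset.mem_range]
  constructor
  · rintro ⟨hi, hu'⟩
    exact ((h i hi).1 hu').symm
  · rintro ⟨hi, hu'⟩
    exact ⟨by omega, (h i (by omega)).2 ⟨hu', hi⟩⟩

theorem count_lt_stat (hp : p < k) (hu : Unrestricted L p) :
    Nat.count (Unrestricted L) p < stat (k, L) :=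
  Nat.count_strict_mono hu hp

theorem word_addRow (h : IsColumnList k L) : word (k + 1) L = word k L ++ [true] := by
  have : L.countP (fun c => c.1 = k + 1) = 0 := by
    rw [List.countP_eq_zero]
    intro c hc
    have := (h.1 c hc).2
    simp only [decide_eq_true_eq]
    omega
  simp [word, List.range_succ, this]

theorem word_addColumn (hp : p < k) : word k ((k, p) :: L) = word k L ++ [false] := by
  obtain ⟨k, rfl⟩ : ∃ j, k = j + 1 := ⟨k - 1, by omega⟩
  have h : ∀ i ∈ List.range k,
      true :: List.replicate (((k + 1, p) :: L).countP fun c => c.1 = i + 1) false =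
        true :: List.replicate (L.countP fun c => c.1 = i + 1) false := by
    intro i hi
    rw [List.mem_range] at hi
    rw [List.countP_cons_of_neg]
    simp only [decide_eq_true_eq]
    omega
  simp only [word, List.range_succ, List.flatMap_append, List.flatMap_congr h]
  simp [List.replicate_succ']

theorem eq_addRow_or_eq_addColumn {q : ℕ × List (ℕ × ℕ)} {n : ℕ} (h : IsColumnList q.1 q.2)
    (hn : q.1 + q.2.length = n + 1) :
    (∃ k L, q = (k + 1, L) ∧ IsColumnList k L) ∨
      ∃ k p L, q = (k, (k, p) :: L) ∧ IsColumnList k L ∧ p < k ∧ Unrestricted L p := by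
  obtain ⟨k, L⟩ := q
  dsimp only at h hn
  by_cases hk : ∃ p L', L = (k, p) :: L'
  · obtain ⟨p, L, rfl⟩ := hk
    exact Or.inr ⟨k, p, L, rfl, addColumn_iff.1 h⟩
  · left
    have hlt : ∀ c ∈ L, c.1 < k := by
      cases L with
      | nil => simp
      | cons c L =>
        have hc := h.1 c (by simp)
        have hck : c.1 ≠ k := fun e => hk ⟨c.2, L, by rw [← e]⟩
        rw [List.forall_mem_cons]
        refine ⟨by omega, fun d hd => ?_⟩
        have := ((List.pairwise_cons.1 h.2).1 d hd).1
        omega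
    have hk0 : k ≠ 0 := by
      rintro rfl
      cases L with
      | nil => simp at hn
      | cons c L => exact absurd (hlt c (by simp)) (by omega)
    obtain ⟨k, rfl⟩ := Nat.exists_eq_succ_of_ne_zero hk0
    exact ⟨k, L, rfl, fun c hc => ⟨(h.1 c hc).1, Nat.lt_succ_iff.1 (hlt c hc)⟩, h.2⟩

/-- Column lists, graded by the number of rows and columns, with the number of unrestricted rows
as statistic. -/
def catalanFamily : CatalanFamily fun n =>
    {q : ℕ × List (ℕ × ℕ) // IsColumnList q.1 q.2 ∧ q.1 + q.2.length = n} where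
  stat q := stat q.1
  word q := word q.1.1 q.1.2
  parent q := ⟨parent q.1, by
    obtain ⟨q, h, hn⟩ := q
    obtain ⟨k, L, rfl, h'⟩ | ⟨k, p, L, rfl, h', -⟩ := eq_addRow_or_eq_addColumn h hn
    · rw [parent_addRow h']
      dsimp only at hn ⊢
      exact ⟨h', by omega⟩
    · rw [parent_addColumn]
      rw [List.length_cons] at hn
      dsimp only at hn ⊢
      exact ⟨h', by omega⟩⟩
  root := ⟨(0, []), by simp [IsColumnList]⟩
  eq_root := by
    rintro ⟨⟨k, L⟩, h, hn⟩
    obtain ⟨rfl, hL⟩ : k = 0 ∧ L = [] := by simpa using hn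
    subst hL
    rfl
  stat_root := rfl
  word_root := rfl
  stat_pos := by
    rintro n ⟨q, h, hn⟩
    obtain ⟨k, L, rfl, h'⟩ | ⟨k, p, L, rfl, h', hp, hu⟩ := eq_addRow_or_eq_addColumn h hn
    · simp [stat_addRow h']
    · simp [stat_addColumn hp hu]
  stat_le := by
    rintro n ⟨q, h, hn⟩
    obtain ⟨k, L, rfl, h'⟩ | ⟨k, p, L, rfl, h', hp, hu⟩ := eq_addRow_or_eq_addColumn h hn
    · simp [stat_addRow h', parent_addRow h']
    · simp [stat_addColumn hp hu, parent_addColumn, (count_lt_stat hp hu).le]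
  parent_inj := by
    rintro n ⟨q, h, hn⟩ ⟨q', g, gn⟩ hpar hstat
    simp only [Subtype.mk.injEq] at hpar hstat ⊢
    obtain ⟨k, L, rfl, h'⟩ | ⟨k, p, L, rfl, h', hp, hu⟩ := eq_addRow_or_eq_addColumn h hn <;>
    obtain ⟨j, M, rfl, g'⟩ | ⟨j, r, M, rfl, g', gp, gu⟩ := eq_addRow_or_eq_addColumn g gn
    · rw [parent_addRow h', parent_addRow g', Prod.mk.injEq] at hpar
      rw [hpar.1, hpar.2]
    · rw [parent_addRow h', parent_addColumn] at hpar
      rw [stat_addRow h', stat_addColumn gp gu, hpar] at hstat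
      have := count_lt_stat gp gu
      omega
    · rw [parent_addColumn, parent_addRow g'] at hpar
      rw [stat_addColumn hp hu, stat_addRow g', ← hpar] at hstat
      have := count_lt_stat hp hu
      omega
    · rw [parent_addColumn, parent_addColumn, Prod.mk.injEq] at hpar
      obtain ⟨rfl, rfl⟩ := hpar
      rw [stat_addColumn hp hu, stat_addColumn gp gu, Nat.add_right_cancel_iff] at hstat
      rw [Nat.count_injective hu gu hstat]
  exists_child := by
    rintro n ⟨⟨k, L⟩, h, hn⟩ t ht
    dsimp only at h hn ht
    simp only [Subtype.mk.injEq]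
    obtain rfl | ht := ht.eq_or_lt
    · exact ⟨⟨(k + 1, L), h.addRow, by dsimp only; omega⟩, parent_addRow h, stat_addRow h⟩
    · have hp : Nat.nth (Unrestricted L) t < k := Nat.nth_lt_of_lt_count ht
      have hcard : ∀ hf : {i | Unrestricted L i}.Finite, t < hf.toFinset.card :=
        fun hf => lt_of_lt_of_le ht (Nat.count_le_card hf k)
      have hu := Nat.nth_mem t hcard
      refine ⟨⟨(k, (k, Nat.nth (Unrestricted L) t) :: L), addColumn_iff.2 ⟨h, hp, hu⟩, ?_⟩,
        parent_addColumn, ?_⟩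
      · rw [List.length_cons]
        dsimp only
        omega
      · rw [stat_addColumn hp hu, Nat.count_nth hcard]
  word_succ := by
    rintro n ⟨q, h, hn⟩
    obtain ⟨k, L, rfl, h'⟩ | ⟨k, p, L, rfl, h', hp, hu⟩ := eq_addRow_or_eq_addColumn h hn
    · simp [stat_addRow h', parent_addRow h', word_addRow h']
    · simp [stat_addColumn hp hu, parent_addColumn, word_addColumn hp, (count_lt_stat hp hu).ne]

end IsColumnList

theorem Fin.lt_card_filter_iff {k : ℕ} (P : Fin k → Prop) [DecidablePred P]
    (hP : ∀ i j, i ≤ j → P j → P i) (i : Fin k) :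
    (i : ℕ) < (Finset.univ.filter P).card ↔ P i := by
  constructor
  · intro h
    by_contra hi
    have hsub : Finset.univ.filter P ⊆ Finset.Iio i := by
      intro j hj
      rw [Finset.mem_filter] at hj
      rw [Finset.mem_Iio]
      by_contra hij
      exact hi (hP i j (not_lt.1 hij) hj.2)
    have := Finset.card_le_card hsub
    rw [Fin.card_Iio] at this
    omega
  · intro hi
    have hsub : Finset.Iic i ⊆ Finset.univ.filter P := by
      intro j hj
      rw [Finset.mem_Iic] at hj
      simpa using hP j i hj hi
    have := Finset.card_le_card hsub
    rw [Fin.card_Iic] at this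
    omega

theorem Fin.sub_card_filter_le_iff {m : ℕ} (P : Fin m → Prop) [DecidablePred P]
    (hP : ∀ i j, i ≤ j → P i → P j) (j : Fin m) :
    m - (Finset.univ.filter P).card ≤ (j : ℕ) ↔ P j := by
  have h := Fin.lt_card_filter_iff (fun j => ¬ P j) (fun i j hij hj hi => hj (hP i j hij hi)) j
  have hc := Finset.card_filter_add_card_filter_not (s := (Finset.univ : Finset (Fin m))) P
  rw [Finset.card_univ, Fintype.card_fin] at hc
  rw [← not_iff_not, ← h]
  omega

theorem List.countP_ofFn {α : Type*} {m : ℕ} (g : Fin m → α) (p : α → Bool) :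
    (List.ofFn g).countP p = (Finset.univ.filter fun j => p (g j) = true).card := by
  rw [List.ofFn_eq_map, List.countP_map, List.countP_eq_length_filter]
  rw [← List.toFinset_card_of_nodup ((List.nodup_finRange m).filter _)]
  congr 1
  ext j
  simp

namespace CatalanTableau

variable {n : ℕ} (T : CatalanTableau n)

/-- The number of cells in column `j`. -/
def height (j : Fin T.m) : ℕ := (Finset.univ.filter fun i => T.m - T.lam i ≤ (j : ℕ)).card

/-- The row of the unique `1` of column `j`. -/
noncomputable def onePos (j : Fin T.m) : Fin T.k := (T.col_one j).choose

theorem f_eq_true_iff (i : Fin T.k) (j : Fin T.m) : T.f i j = true ↔ T.onePos j = i :=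
  ⟨fun h => ((T.col_one j).choose_spec.2 i h).symm,
    fun h => h ▸ (T.col_one j).choose_spec.1⟩

theorem lt_height_iff (i : Fin T.k) (j : Fin T.m) :
    (i : ℕ) < T.height j ↔ T.m - T.lam i ≤ (j : ℕ) :=
  Fin.lt_card_filter_iff (fun i => T.m - T.lam i ≤ (j : ℕ))
    (fun i i' hi h => by have := T.lam_anti i i' hi; omega) i

theorem height_le (j : Fin T.m) : T.height j ≤ T.k :=
  (Finset.card_filter_le _ _).trans (by simp)

theorem height_mono {j j' : Fin T.m} (h : j ≤ j') : T.height j ≤ T.height j' :=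
  Finset.card_le_card <| Finset.monotone_filter_right _ fun _ _ hi =>
    le_trans hi (show (j : ℕ) ≤ j' from h)

theorem onePos_lt_height (j : Fin T.m) : (T.onePos j : ℕ) < T.height j := by
  rw [lt_height_iff]
  by_contra h
  have h1 := T.f_outside (T.onePos j) j (by omega)
  rw [(T.f_eq_true_iff _ j).2 rfl] at h1
  exact absurd h1 (by simp)

theorem lam_eq_card (i : Fin T.k) :
    T.lam i = (Finset.univ.filter fun j => (i : ℕ) < T.height j).card := by
  have h : (Finset.univ.filter fun j => (i : ℕ) < T.height j) =
      Finset.univ.filter fun j : Fin T.m => ¬ ((j : ℕ) < T.m - T.lam i) := by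
    ext j
    simp [lt_height_iff]
  have hc := Finset.card_filter_add_card_filter_not (s := (Finset.univ : Finset (Fin T.m)))
    fun j : Fin T.m => (j : ℕ) < T.m - T.lam i
  rw [Finset.card_univ, Fintype.card_fin, Fin.card_filter_val_lt] at hc
  have := T.lam_le i
  rw [h]
  omega

/-- The list of columns, from right to left, each recorded as its height and the row of its
unique `1`. -/
noncomputable def columns : List (ℕ × ℕ) :=
  (List.ofFn fun j => (T.height j, (T.onePos j : ℕ))).reverse

theorem length_columns : T.columns.length = T.m := by simp [columns]

theorem isColumnList_columns : IsColumnList T.k T.columns := by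
  constructor
  · intro c hc
    rw [columns, List.mem_reverse, List.mem_ofFn] at hc
    obtain ⟨j, rfl⟩ := hc
    exact ⟨T.onePos_lt_height j, T.height_le j⟩
  · rw [columns, List.pairwise_reverse, List.pairwise_ofFn]
    intro j j' hj
    refine ⟨T.height_mono hj.le, fun h => ?_⟩
    by_contra hlt
    dsimp only at h hlt
    refine T.no_bad (T.onePos j') j ((T.lt_height_iff _ _).1 h) ?_
      ⟨⟨T.onePos j, not_le.1 hlt, (T.f_eq_true_iff _ _).2 rfl⟩,
        ⟨j', hj, (T.f_eq_true_iff _ _).2 rfl⟩⟩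
    rw [Bool.eq_false_iff, Ne, f_eq_true_iff]
    intro e
    exact hlt (e ▸ le_rfl)

theorem lam_eq_countP (i : Fin T.k) :
    T.lam i = T.columns.countP fun c => (i : ℕ) < c.1 := by
  rw [columns, List.countP_reverse, List.countP_ofFn, lam_eq_card]
  simp

theorem profile_eq : T.profile = (IsColumnList.word T.k T.columns).tail := by
  have hsum : ∀ (L : List (ℕ × ℕ)) (i : ℕ), L.countP (fun c => i < c.1) =
      L.countP (fun c => c.1 = i + 1) + L.countP fun c => i + 1 < c.1 := by
    intro L i
    induction L with
    | nil => rfl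
    | cons c L ih =>
      simp only [List.countP_cons, ih, decide_eq_true_eq]
      split_ifs <;> omega
  rw [profile, IsColumnList.word, ← List.map_coe_finRange_eq_range, List.flatMap_map]
  congr 1
  refine List.flatMap_congr fun i _ => ?_
  congr 2
  have h := hsum T.columns i
  rw [← T.lam_eq_countP i] at h
  split_ifs with hi
  · rw [T.lam_eq_countP ⟨i + 1, hi⟩]
    dsimp only
    omega
  · have h0 : (T.columns.countP fun c => (i : ℕ) + 1 < c.1) = 0 := by
      rw [List.countP_eq_zero]
      intro c hc
      have := (T.isColumnList_columns.1 c hc).2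
      simp only [decide_eq_true_eq]
      omega
    omega

theorem ext_columns {T T' : CatalanTableau n} (hk : T.k = T'.k)
    (hL : T.columns = T'.columns) : T = T' := by
  have hm : T.m = T'.m := by rw [← T.length_columns, hL, T'.length_columns]
  have hlam : ∀ i : Fin T.k, T.lam i = T'.lam (i.cast hk) := by
    intro i
    rw [lam_eq_countP, lam_eq_countP, hL]
    rfl
  have hf : ∀ (i : Fin T.k) (j : Fin T.m), T.f i j = T'.f (i.cast hk) (j.cast hm) := by
    intro i j
    rw [Bool.eq_iff_iff, f_eq_true_iff, f_eq_true_iff, Fin.ext_iff, Fin.ext_iff]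
    have h := List.reverse_injective hL
    have h1 := congrArg (fun M => M[(j : ℕ)]?) h
    have hj := j.2
    have hj' : (j : ℕ) < T'.m := hm ▸ j.2
    simp only [List.getElem?_ofFn, hj, hj', dif_pos, Option.some.injEq, Prod.mk.injEq] at h1
    rw [Fin.val_cast]
    exact Eq.congr_left h1.2
  obtain ⟨k, m, _, _, lam, _, _, _, f, _, _, _⟩ := T
  obtain ⟨k', m', _, _, lam', _, _, _, f', _, _, _⟩ := T'
  dsimp only at hk hm
  subst hk hm
  obtain rfl : lam = lam' := funext hlam
  obtain rfl : f = f' := funext fun i => funext (hf i)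
  rfl

theorem exists_columns_eq {k : ℕ} {L : List (ℕ × ℕ)} (hk : 0 < k) (h : IsColumnList k L)
    (hn : k + L.length = n) : ∃ T : CatalanTableau n, T.k = k ∧ T.columns = L := by
  obtain ⟨m, g, hL⟩ : ∃ m, ∃ g : Fin m → ℕ × ℕ, L = (List.ofFn g).reverse :=
    ⟨_, L.reverse.get, by rw [List.ofFn_get, List.reverse_reverse]⟩
  have hm : L.length = m := by simp [hL]
  have hg : ∀ j, (g j).2 < (g j).1 ∧ (g j).1 ≤ k := fun j => h.1 _ (by simp [hL])
  have hpair : ∀ j j', j < j' → (g j).1 ≤ (g j').1 ∧ ((g j').2 < (g j).1 → (g j').2 ≤ (g j).2) := by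
    have := h.2
    rw [hL, List.pairwise_reverse, List.pairwise_ofFn] at this
    exact fun j j' hj => this hj
  have hmono : ∀ j j', j ≤ j' → (g j).1 ≤ (g j').1 := by
    intro j j' hj
    obtain rfl | hj := hj.eq_or_lt
    · exact le_rfl
    · exact (hpair j j' hj).1
  let lam : Fin k → ℕ := fun i => (Finset.univ.filter fun j => (i : ℕ) < (g j).1).card
  have hlam : ∀ (i : Fin k) (j : Fin m), m - lam i ≤ (j : ℕ) ↔ (i : ℕ) < (g j).1 := fun i j =>
    Fin.sub_card_filter_le_iff (fun j => (i : ℕ) < (g j).1)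
      (fun j j' hj hi => hi.trans_le (hmono j j' hj)) j
  let T : CatalanTableau n :=
    { k := k
      m := m
      hk := hk
      hkm := by omega
      lam := lam
      lam_le := fun i => by
        simpa using Finset.card_filter_le (Finset.univ : Finset (Fin m)) fun j => (i : ℕ) < (g j).1
      lam_first := by
        have : ∀ j, 0 < (g j).1 := fun j => (Nat.zero_le _).trans_lt (hg j).1
        simp [lam, this]
      lam_anti := fun i i' hi => Finset.card_le_card <| Finset.monotone_filter_right _
        fun j _ hj => lt_of_le_of_lt (show (i : ℕ) ≤ i' from hi) hj
      f := fun i j => decide ((g j).2 = i)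
      f_outside := fun i j hj => by
        have h1 := mt (hlam i j).2 (by omega)
        have h2 := (hg j).1
        rw [decide_eq_false_iff_not]
        omega
      col_one := fun j => by
        refine ⟨⟨(g j).2, (hg j).1.trans_le (hg j).2⟩, by simp, fun i hi => ?_⟩
        exact Fin.ext (of_decide_eq_true hi).symm
      no_bad := by
        rintro i j hj - ⟨⟨i', hi', h1⟩, ⟨j', hj', h2⟩⟩
        rw [decide_eq_true_eq] at h1 h2
        rw [hlam] at hj
        rw [← h2] at hj
        have h3 := (hpair j j' hj').2 hj
        rw [h1, h2] at h3
        exact absurd hi' (not_lt.2 h3) }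
  refine ⟨T, rfl, ?_⟩
  have hheight : ∀ j : Fin m, T.height j = (g j).1 := by
    intro j
    have h1 : T.height j ≤ k := T.height_le j
    have h2 := (hg j).2
    have h3 : ∀ i : Fin k, (i : ℕ) < T.height j ↔ (i : ℕ) < (g j).1 := fun i =>
      (T.lt_height_iff i j).trans (hlam i j)
    by_contra hne
    obtain hlt | hlt := Nat.lt_or_gt_of_ne hne
    · exact absurd ((h3 ⟨T.height j, by omega⟩).2 hlt) (lt_irrefl _)
    · exact absurd ((h3 ⟨(g j).1, by omega⟩).1 hlt) (lt_irrefl _)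
  have hpos : ∀ j : Fin m, (T.onePos j : ℕ) = (g j).2 := by
    intro j
    have h1 : T.f (T.onePos j) j = true := (T.f_eq_true_iff _ _).2 rfl
    exact (of_decide_eq_true h1).symm
  rw [columns, hL]
  congr 2
  funext j
  exact Prod.ext (hheight j) (hpos j)

/-- A Catalan tableau of positive index amounts to its list of columns. -/
noncomputable def columnEquiv (hn : 1 ≤ n) : CatalanTableau n ≃
    {q : ℕ × List (ℕ × ℕ) // IsColumnList q.1 q.2 ∧ q.1 + q.2.length = n} :=
  Equiv.ofBijective
    (fun T => ⟨(T.k, T.columns), T.isColumnList_columns, by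
      dsimp only; rw [T.length_columns, T.hkm]⟩) <| by
    constructor
    · intro T T' h
      simp only [Subtype.mk.injEq, Prod.mk.injEq] at h
      exact ext_columns h.1 h.2
    · rintro ⟨⟨k, L⟩, h, hkL⟩
      dsimp only at h hkL
      have hk : 0 < k := by
        rcases L with - | ⟨c, L⟩
        · rw [List.length_nil] at hkL
          omega
        · have := h.1 c (by simp)
          omega
      obtain ⟨T, hTk, hTL⟩ := exists_columns_eq hk h hkL
      exact ⟨T, Subtype.ext (Prod.ext hTk hTL)⟩

end CatalanTableau

/-- For every integer `n ≥ 1` there exists a bijection `φ` from the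
set of Catalan tableaux of index `n` to the set of binary trees with `n`
vertices such that for every Catalan tableau `T` of index `n`, the profile of
`T` equals the canopy of `φ(T)`. -/
theorem catalanTableau_equiv_binTree_profile_eq_canopy (n : ℕ) (hn : 1 ≤ n) :
    ∃ e : CatalanTableau n ≃ {B : BinTree // B.size = n},
      ∀ T : CatalanTableau n, T.profile = (e T).val.canopy := by
  obtain ⟨e, he⟩ := IsColumnList.catalanFamily.exists_equiv BinTree.catalanFamily n
  refine ⟨(CatalanTableau.columnEquiv hn).trans e, fun T => ?_⟩
  have h := (he (CatalanTableau.columnEquiv hn T)).2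
  have htail : ∀ B : BinTree, B.canopyWord.tail = B.canopy := by
    intro B
    cases B <;> rfl
  rw [T.profile_eq, Equiv.trans_apply, ← htail]
  exact congrArg List.tail h
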